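/- Let N ≥ 3 and p ∈ (1, N/(N-2)); set α := -2/(p-1) (so α < 2-N) and k := α(α+N-2)/(N-1) (so k > 0), and let A_p(x) := k·I + (1-k)·(x/‖x‖)(x/‖x‖)ᵀ for x ≠ 0. Then for every q with 1 < q ≤ p and every ρ > 0, there is no function u : ℝ^N → ℝ which is C² on C₊ ∩ {x : ‖x‖ > ρ}, positive there, and satisfies -div(A_p∇u)(x) ≥ u(x)^q for all x ∈ C₊ with ‖x‖ > ρ. (Nonexistence half of the paper's Theorem 1.4 realized on the half-space cone with the explicit matrix A_p; the critical exponent q = p is included in the nonexistence range.) -/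

import Mathlib

/-- The divergence-form operator `div(A∇u)(x) = ∑_i ∂_i(∑_j A_{ij} ∂_j u)(x)`. -/
noncomputable def divAgrad {N : ℕ}
    (A : EuclideanSpace ℝ (Fin N) → Matrix (Fin N) (Fin N) ℝ)
    (u : EuclideanSpace ℝ (Fin N) → ℝ) (x : EuclideanSpace ℝ (Fin N)) : ℝ :=
  ∑ i, fderiv ℝ
    (fun y => ∑ j, A y i j * fderiv ℝ u y (EuclideanSpace.single j 1)) x
    (EuclideanSpace.single i 1)

/-- The matrix field `A(x) = k·I + (1-k)·(x/‖x‖)(x/‖x‖)ᵀ`. -/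
noncomputable def Amat {N : ℕ} (k : ℝ) (x : EuclideanSpace ℝ (Fin N)) :
    Matrix (Fin N) (Fin N) ℝ :=
  Matrix.of fun i j => k * (if i = j then 1 else 0) + (1 - k) * (x i * x j) / ‖x‖ ^ 2

/-- The last coordinate `x_N` of `x ∈ ℝ^N`. -/
def lastCoord {N : ℕ} (x : EuclideanSpace ℝ (Fin N)) : ℝ :=
  if h : 0 < N then x ⟨N - 1, Nat.sub_lt h Nat.one_pos⟩ else 0

section Operator

open Filter Topology Set

variable {N : ℕ}

lemma sum_coord_mul_clm (L : EuclideanSpace ℝ (Fin N) →L[ℝ] ℝ) (z : EuclideanSpace ℝ (Fin N)) :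
    ∑ j, z j * L (EuclideanSpace.single j 1) = L z := by
  conv_rhs => rw [← (EuclideanSpace.basisFun (Fin N) ℝ).sum_repr z]
  simp [map_sum]

lemma sum_coord_sq (z : EuclideanSpace ℝ (Fin N)) : ∑ j, z j * z j = ‖z‖ ^ 2 := by
  rw [EuclideanSpace.real_norm_sq_eq]
  exact Finset.sum_congr rfl fun j _ => (sq _).symm

lemma coord_sq_le_norm_sq (z : EuclideanSpace ℝ (Fin N)) (n : Fin N) : z n ^ 2 ≤ ‖z‖ ^ 2 := by
  rw [EuclideanSpace.real_norm_sq_eq]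
  exact Finset.single_le_sum (f := fun i => z i ^ 2) (fun i _ => sq_nonneg _) (Finset.mem_univ n)

/-- The nondivergence form of the operator `div(A∇u)`. -/
lemma divAgrad_Amat (k : ℝ) {u : EuclideanSpace ℝ (Fin N) → ℝ} {x : EuclideanSpace ℝ (Fin N)}
    (hx : x ≠ 0) (hu : ContDiffAt ℝ 2 u x) :
    divAgrad (Amat k) u x =
      k * ∑ i, fderiv ℝ (fderiv ℝ u) x (EuclideanSpace.single i 1) (EuclideanSpace.single i 1)
      + (1 - k) / ‖x‖ ^ 2 * (fderiv ℝ (fderiv ℝ u) x x x + ((N : ℝ) - 1) * fderiv ℝ u x x) := by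
  have hs : ‖x‖ ^ 2 ≠ 0 := by positivity
  have hF : HasFDerivAt (fderiv ℝ u) (fderiv ℝ (fderiv ℝ u) x) x :=
    ((hu.fderiv_right (m := 1) (by norm_num)).differentiableAt (by norm_num)).hasFDerivAt
  set F' := fderiv ℝ (fderiv ℝ u) x
  set F := fderiv ℝ u
  have hflux (i : Fin N) :
      (fun y => ∑ j, Amat k y i j * F y (EuclideanSpace.single j 1)) =
      fun y => k * F y (EuclideanSpace.single i 1) + (1 - k) * ((‖y‖ ^ 2)⁻¹ * y i * F y y) := by
    funext y
    rw [← sum_coord_mul_clm (F y) y, Finset.mul_sum, Finset.mul_sum]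
    simp only [Amat, Matrix.of_apply, add_mul, Finset.sum_add_distrib]
    congr 1
    · simp
    · exact Finset.sum_congr rfl fun j _ => by ring
  have hderiv (i : Fin N) :
      fderiv ℝ (fun y => ∑ j, Amat k y i j * F y (EuclideanSpace.single j 1)) x
        (EuclideanSpace.single i 1) =
      k * F' (EuclideanSpace.single i 1) (EuclideanSpace.single i 1) + (1 - k) *
        ((‖x‖ ^ 2)⁻¹ * F x x - 2 * ((‖x‖ ^ 2)⁻¹) ^ 2 * F x x * (x i * x i)
         + (‖x‖ ^ 2)⁻¹ * (x i * F' (EuclideanSpace.single i 1) x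
            + x i * F x (EuclideanSpace.single i 1))) := by
    rw [hflux]
    have h1 : HasFDerivAt (fun y => F y (EuclideanSpace.single i 1)) _ x :=
      hF.clm_apply (hasFDerivAt_const _ x)
    have h2 : HasFDerivAt (fun y => F y y) _ x := hF.clm_apply (hasFDerivAt_id x)
    have h3 : HasFDerivAt (fun y : EuclideanSpace ℝ (Fin N) => y i) _ x :=
      (EuclideanSpace.proj (𝕜 := ℝ) i).hasFDerivAt
    have h4 : HasFDerivAt (fun y : EuclideanSpace ℝ (Fin N) => (‖y‖ ^ 2)⁻¹) _ x :=
      (hasDerivAt_inv hs).comp_hasFDerivAt x (hasStrictFDerivAt_norm_sq x).hasFDerivAt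
    have h5 := (h1.const_mul k).add (((h4.mul h3).mul h2).const_mul (1 - k))
    erw [h5.fderiv]
    simp [EuclideanSpace.inner_single_right]
    field_simp
    ring
  have hsum : ∑ i, x i * F' (EuclideanSpace.single i 1) x = F' x x := by
    simpa using sum_coord_mul_clm (F'.flip x) x
  unfold divAgrad
  rw [Finset.sum_congr rfl fun i _ => hderiv i]
  simp only [Finset.sum_add_distrib, Finset.sum_sub_distrib, ← Finset.mul_sum, hsum,
    sum_coord_sq, sum_coord_mul_clm]
  simp
  field_simp
  ring

lemma divAgrad_Amat_add (k : ℝ) {u v : EuclideanSpace ℝ (Fin N) → ℝ}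
    {x : EuclideanSpace ℝ (Fin N)} (hx : x ≠ 0) (hu : ContDiffAt ℝ 2 u x)
    (hv : ContDiffAt ℝ 2 v x) :
    divAgrad (Amat k) (fun y => u y + v y) x =
      divAgrad (Amat k) u x + divAgrad (Amat k) v x := by
  have h1 : fderiv ℝ (fun y => u y + v y) =ᶠ[𝓝 x] fun y => fderiv ℝ u y + fderiv ℝ v y := by
    filter_upwards [hu.eventually (by simp), hv.eventually (by simp)] with y hy hy'
    exact fderiv_fun_add (hy.differentiableAt (by norm_num)) (hy'.differentiableAt (by norm_num))
  have h2 : fderiv ℝ (fderiv ℝ (fun y => u y + v y)) x =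
      fderiv ℝ (fderiv ℝ u) x + fderiv ℝ (fderiv ℝ v) x := by
    rw [h1.fderiv_eq]
    exact fderiv_fun_add
      ((hu.fderiv_right (m := 1) (by norm_num)).differentiableAt (by norm_num))
      ((hv.fderiv_right (m := 1) (by norm_num)).differentiableAt (by norm_num))
  rw [divAgrad_Amat k hx (hu.add hv), divAgrad_Amat k hx hu, divAgrad_Amat k hx hv, h2,
    h1.eq_of_nhds]
  simp only [add_apply, Finset.sum_add_distrib]
  ring

lemma divAgrad_const_mul (A : EuclideanSpace ℝ (Fin N) → Matrix (Fin N) (Fin N) ℝ) (c : ℝ)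
    (u : EuclideanSpace ℝ (Fin N) → ℝ) (x : EuclideanSpace ℝ (Fin N)) :
    divAgrad A (fun y => c * u y) x = c * divAgrad A u x := by
  have h (y : EuclideanSpace ℝ (Fin N)) : fderiv ℝ (fun y => c * u y) y = c • fderiv ℝ u y :=
    congrFun (fderiv_const_smul_field (𝕜 := ℝ) (f := u) c) y
  simp only [divAgrad, h, Finset.mul_sum]
  refine Finset.sum_congr rfl fun i _ => ?_
  have h' : (fun y => ∑ j, A y i j * (c • fderiv ℝ u y) (EuclideanSpace.single j 1)) =
      c • fun y => ∑ j, A y i j * fderiv ℝ u y (EuclideanSpace.single j 1) := by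
    funext y
    simp only [smul_apply, smul_eq_mul, Pi.smul_apply, Finset.mul_sum]
    exact Finset.sum_congr rfl fun j _ => by ring
  rw [h', fderiv_const_smul_field]
  rfl

/-- The second-order necessary condition at a local maximum. -/
lemma IsLocalMax.fderiv_fderiv_nonpos {E : Type*} [NormedAddCommGroup E] [NormedSpace ℝ E]
    {v : E → ℝ} {x : E} (hmax : IsLocalMax v x) (hv : ContDiffAt ℝ 2 v x) (z : E) :
    fderiv ℝ (fderiv ℝ v) x z z ≤ 0 := by
  by_contra! hpos
  have hline (t : ℝ) : HasDerivAt (fun t : ℝ => x + t • z) z t := by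
    simpa using ((hasDerivAt_id t).smul_const z).const_add x
  have htend : Tendsto (fun t : ℝ => x + t • z) (𝓝 0) (𝓝 x) := by
    simpa using (hline 0).continuousAt.tendsto
  have hd : ∀ᶠ t : ℝ in 𝓝 0, deriv (fun t : ℝ => v (x + t • z)) t = fderiv ℝ v (x + t • z) z := by
    filter_upwards [htend.eventually (hv.eventually (by simp))] with t ht
    exact ((ht.differentiableAt (by norm_num)).hasFDerivAt.comp_hasDerivAt t (hline t)).deriv
  have hF : HasFDerivAt (fderiv ℝ v) (fderiv ℝ (fderiv ℝ v) x) (x + (0 : ℝ) • z) := by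
    simpa using ((hv.fderiv_right (m := 1) (by norm_num)).differentiableAt
      (by norm_num)).hasFDerivAt
  have hdd : deriv (deriv fun t : ℝ => v (x + t • z)) 0 = fderiv ℝ (fderiv ℝ v) x z z := by
    rw [EventuallyEq.deriv_eq hd]
    have hFz : HasFDerivAt (fun y => fderiv ℝ v y z) ((fderiv ℝ (fderiv ℝ v) x).flip z)
        (x + (0 : ℝ) • z) := by
      simpa using hF.clm_apply (hasFDerivAt_const z _)
    exact (hFz.comp_hasDerivAt (0 : ℝ) (hline 0)).deriv
  have hmax' : IsLocalMax (fun t : ℝ => v (x + t • z)) 0 := by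
    filter_upwards [htend.eventually hmax] with t ht
    simpa using ht
  have hmin := isLocalMin_of_deriv_deriv_pos (hdd ▸ hpos) hmax'.deriv_eq_zero
    (ContinuousAt.comp' (by simpa using hv.continuousAt) (hline 0).continuousAt)
  have hconst : (fun t : ℝ => v (x + t • z)) =ᶠ[𝓝 0] fun _ => v (x + (0 : ℝ) • z) := by
    filter_upwards [hmax', hmin] with t h1 h2 using le_antisymm h1 h2
  have : deriv (deriv fun t : ℝ => v (x + t • z)) 0 = 0 := by
    rw [hconst.deriv.deriv_eq]
    simp
  linarith

lemma divAgrad_nonpos_of_isLocalMax {k : ℝ} (hk : 0 ≤ k) {v : EuclideanSpace ℝ (Fin N) → ℝ}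
    {x : EuclideanSpace ℝ (Fin N)} (hx : x ≠ 0) (hv : ContDiffAt ℝ 2 v x)
    (hmax : IsLocalMax v x) : divAgrad (Amat k) v x ≤ 0 := by
  have hs : 0 < ‖x‖ ^ 2 := by positivity
  rw [divAgrad_Amat k hx hv, hmax.fderiv_eq_zero]
  set B := fderiv ℝ (fderiv ℝ v) x
  have hB : ∀ z, B z z ≤ 0 := hmax.fderiv_fderiv_nonpos hv
  have hexp (i : Fin N) : B (EuclideanSpace.single i 1 - (x i / ‖x‖ ^ 2) • x)
      (EuclideanSpace.single i 1 - (x i / ‖x‖ ^ 2) • x) =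
      B (EuclideanSpace.single i 1) (EuclideanSpace.single i 1)
      - 1 / ‖x‖ ^ 2 * (x i * B.flip x (EuclideanSpace.single i 1))
      - 1 / ‖x‖ ^ 2 * (x i * B x (EuclideanSpace.single i 1))
      + (1 / ‖x‖ ^ 2) ^ 2 * B x x * (x i * x i) := by
    simp only [map_sub, map_smul, sub_apply, smul_apply,
      smul_eq_mul, ContinuousLinearMap.flip_apply]
    ring
  have hsum : ∑ i, B (EuclideanSpace.single i 1 - (x i / ‖x‖ ^ 2) • x)
      (EuclideanSpace.single i 1 - (x i / ‖x‖ ^ 2) • x) ≤ 0 := Finset.sum_nonpos fun i _ => hB _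
  simp only [hexp, Finset.sum_add_distrib, Finset.sum_sub_distrib, ← Finset.mul_sum,
    sum_coord_sq, sum_coord_mul_clm] at hsum
  rw [ContinuousLinearMap.flip_apply] at hsum
  set T := ∑ i, B (EuclideanSpace.single i 1) (EuclideanSpace.single i 1)
  have hT : T - B x x / ‖x‖ ^ 2 ≤ 0 := by
    convert hsum using 1
    field_simp
    ring
  have hxx : B x x / ‖x‖ ^ 2 ≤ 0 := div_nonpos_of_nonpos_of_nonneg (hB x) hs.le
  have : k * T + (1 - k) / ‖x‖ ^ 2 * (B x x + ((N : ℝ) - 1) * (0 : EuclideanSpace ℝ (Fin N) →L[ℝ] ℝ) x)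
      = k * (T - B x x / ‖x‖ ^ 2) + B x x / ‖x‖ ^ 2 := by
    simp
    ring
  rw [this]
  nlinarith [mul_nonpos_of_nonneg_of_nonpos hk hT]

/-- If `w - τ u` has a local maximum at `x`, then `div(A∇w)(x) ≤ τ div(A∇u)(x)`. -/
lemma divAgrad_le_of_isLocalMax_sub {k : ℝ} (hk : 0 ≤ k) (τ : ℝ)
    {u w : EuclideanSpace ℝ (Fin N) → ℝ} {x : EuclideanSpace ℝ (Fin N)} (hx : x ≠ 0)
    (hu : ContDiffAt ℝ 2 u x) (hw : ContDiffAt ℝ 2 w x)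
    (hmax : IsLocalMax (fun y => w y - τ * u y) x) :
    divAgrad (Amat k) w x ≤ τ * divAgrad (Amat k) u x := by
  have hτu : ContDiffAt ℝ 2 (fun y => -τ * u y) x := contDiffAt_const.mul hu
  have heq : (fun y => w y - τ * u y) = fun y => w y + -τ * u y := by
    funext y
    ring
  rw [heq] at hmax
  have := divAgrad_nonpos_of_isLocalMax hk hx (hw.add hτu) hmax
  rw [divAgrad_Amat_add k hx hw hτu, divAgrad_const_mul] at this
  linarith

end Operator

section RadialPolynomials

open Filter Topology Set

variable {N : ℕ}

lemma hasFDerivAt_radial_mul_coord_pow {g : ℝ → ℝ} {g' : ℝ} {x : EuclideanSpace ℝ (Fin N)}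
    (hg : HasDerivAt g g' (‖x‖ ^ 2)) (n : Fin N) (j : ℕ) :
    HasFDerivAt (fun y : EuclideanSpace ℝ (Fin N) => g (‖y‖ ^ 2) * y n ^ j)
      ((2 * g' * x n ^ j) • innerSL ℝ x +
        (j * (g (‖x‖ ^ 2) * x n ^ (j - 1))) • EuclideanSpace.proj (𝕜 := ℝ) n) x := by
  have h1 : HasFDerivAt (fun y : EuclideanSpace ℝ (Fin N) => g (‖y‖ ^ 2)) _ x :=
    hg.comp_hasFDerivAt x (hasStrictFDerivAt_norm_sq x).hasFDerivAt
  have h2 : HasFDerivAt (fun y : EuclideanSpace ℝ (Fin N) => y n ^ j) _ x :=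
    ((EuclideanSpace.proj (𝕜 := ℝ) n).hasFDerivAt (x := x)).pow j
  refine (h1.mul h2).congr_fderiv ?_
  ext z
  simp
  ring

lemma contDiffAt_radial_mul_coord_pow {g : ℝ → ℝ} (hg : ContDiffOn ℝ 2 g (Ioi 0))
    (n : Fin N) (j : ℕ) {x : EuclideanSpace ℝ (Fin N)} (hx : x ≠ 0) :
    ContDiffAt ℝ 2 (fun y : EuclideanSpace ℝ (Fin N) => g (‖y‖ ^ 2) * y n ^ j) x := by
  have hs : ‖x‖ ^ 2 ∈ Ioi (0 : ℝ) := by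
    simp [hx]
  have h1 : ContDiffAt ℝ 2 (fun y : EuclideanSpace ℝ (Fin N) => g (‖y‖ ^ 2)) x :=
    (hg.contDiffAt (isOpen_Ioi.mem_nhds hs)).comp x (contDiff_norm_sq ℝ).contDiffAt
  exact h1.mul ((EuclideanSpace.proj (𝕜 := ℝ) n).contDiff.contDiffAt.pow j)

lemma divAgrad_radial_mul_coord_pow (k : ℝ) {g g' g'' : ℝ → ℝ}
    (hc : ContDiffOn ℝ 2 g (Ioi 0)) (hg : ∀ s, 0 < s → HasDerivAt g (g' s) s)
    (hg' : ∀ s, 0 < s → HasDerivAt g' (g'' s) s) (n : Fin N) (j : ℕ)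
    {x : EuclideanSpace ℝ (Fin N)} (hx : x ≠ 0) :
    divAgrad (Amat k) (fun y => g (‖y‖ ^ 2) * y n ^ j) x =
      x n ^ j * (4 * ‖x‖ ^ 2 * g'' (‖x‖ ^ 2) + (2 * N + 4 * j) * g' (‖x‖ ^ 2)
        + (1 - k) * j * (N + j - 2) * g (‖x‖ ^ 2) / ‖x‖ ^ 2)
      + k * (j * (j - 1)) * (g (‖x‖ ^ 2) * x n ^ (j - 2)) := by
  have hpos : 0 < ‖x‖ ^ 2 := by positivity
  set D : EuclideanSpace ℝ (Fin N) → EuclideanSpace ℝ (Fin N) →L[ℝ] ℝ := fun y =>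
    (2 * g' (‖y‖ ^ 2) * y n ^ j) • innerSL ℝ y +
      (j * (g (‖y‖ ^ 2) * y n ^ (j - 1))) • EuclideanSpace.proj (𝕜 := ℝ) n with hD
  have hfd : fderiv ℝ (fun y : EuclideanSpace ℝ (Fin N) => g (‖y‖ ^ 2) * y n ^ j) =ᶠ[𝓝 x] D := by
    filter_upwards [isOpen_ne.mem_nhds hx] with y hy
    exact (hasFDerivAt_radial_mul_coord_pow (hg _ (by have := norm_pos_iff.mpr hy; positivity)) n j).fderiv
  have hP := (hasFDerivAt_radial_mul_coord_pow (hg' _ hpos) n j).const_mul 2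
  have hQ := (hasFDerivAt_radial_mul_coord_pow (hg _ hpos) n (j - 1)).const_mul (j : ℝ)
  have hDD (z : EuclideanSpace ℝ (Fin N)) : fderiv ℝ D x z z =
      4 * g'' (‖x‖ ^ 2) * x n ^ j * (inner ℝ x z) ^ 2
      + 4 * (j * (g' (‖x‖ ^ 2) * x n ^ (j - 1))) * (z n * inner ℝ x z)
      + 2 * g' (‖x‖ ^ 2) * x n ^ j * ‖z‖ ^ 2
      + (j * (j - 1)) * (g (‖x‖ ^ 2) * x n ^ (j - 2)) * z n ^ 2 := by
    let B : EuclideanSpace ℝ (Fin N) →L[ℝ] EuclideanSpace ℝ (Fin N) →L[ℝ] ℝ := innerSL ℝ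
    have hB (y z : EuclideanSpace ℝ (Fin N)) : B y z = inner ℝ y z := rfl
    have hB' (y z : EuclideanSpace ℝ (Fin N)) : innerSL ℝ y z = inner ℝ y z := rfl
    have hproj (z : EuclideanSpace ℝ (Fin N)) : EuclideanSpace.proj (𝕜 := ℝ) n z = z n := rfl
    have h1 := (hP.smul (B.hasFDerivAt (x := x))).add
      (hQ.smul_const (EuclideanSpace.proj (𝕜 := ℝ) n))
    have h2 : HasFDerivAt D _ x := h1.congr_of_eventuallyEq (Eventually.of_forall fun y => by
      simp only [hD, Pi.add_apply, Pi.smul_apply', ← mul_assoc]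
      rfl)
    rw [h2.fderiv]
    simp only [add_apply, smul_apply, ContinuousLinearMap.smulRight_apply, hB, hB', smul_eq_mul,
      hproj, real_inner_self_eq_norm_sq]
    rcases j with _ | j
    · simp
      ring
    · simp only [Nat.add_sub_cancel]
      push_cast
      ring
  rw [divAgrad_Amat k hx (contDiffAt_radial_mul_coord_pow hc n j hx), hfd.fderiv_eq,
    hfd.eq_of_nhds]
  have hD1 : D x x = 2 * g' (‖x‖ ^ 2) * x n ^ j * ‖x‖ ^ 2
      + j * (g (‖x‖ ^ 2) * x n ^ (j - 1)) * x n := by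
    have h : (innerSL ℝ x) x = ‖x‖ ^ 2 := real_inner_self_eq_norm_sq x
    simp only [hD, add_apply, smul_apply, h, smul_eq_mul]
    rfl
  have hpow1 : (j : ℝ) * x n ^ (j - 1) * x n = j * x n ^ j := by
    rcases j with _ | j
    · simp
    · rw [mul_assoc, ← pow_succ, Nat.add_sub_cancel]
  have hpow2 : (j * (j - 1) : ℝ) * x n ^ (j - 2) * x n ^ 2 = (j * (j - 1)) * x n ^ j := by
    rcases j with _ | _ | j
    · simp
    · simp
    · rw [mul_assoc, ← pow_add]
      rfl
  have hs1 : ∑ i, inner ℝ x (EuclideanSpace.single i 1) ^ 2 = ‖x‖ ^ 2 := by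
    simp [EuclideanSpace.inner_single_right, EuclideanSpace.real_norm_sq_eq]
  have hs2 : ∑ i, (EuclideanSpace.single i 1 : EuclideanSpace ℝ (Fin N)) n *
      inner ℝ x (EuclideanSpace.single i 1) = x n := by
    simp [EuclideanSpace.inner_single_right]
  have hs3 : ∑ i, (EuclideanSpace.single i 1 : EuclideanSpace ℝ (Fin N)) n ^ 2 = 1 := by
    simp
  have hs4 : ∑ i, ‖(EuclideanSpace.single i 1 : EuclideanSpace ℝ (Fin N))‖ ^ 2 = (N : ℝ) := by
    simp
  simp only [hDD, Finset.sum_add_distrib, ← Finset.mul_sum, hs1, hs2, hs3, hs4, hD1,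
    real_inner_self_eq_norm_sq]
  set s := ‖x‖ ^ 2
  set a := x n
  have e1 : 4 * (j * (g' s * a ^ (j - 1))) * a = 4 * g' s * (j * a ^ j) := by
    rw [← hpow1]
    ring
  have e2 : (j * (j - 1)) * (g s * a ^ (j - 2)) * a ^ 2 = g s * ((j * (j - 1)) * a ^ j) := by
    rw [← hpow2]
    ring
  have e3 : j * (g s * a ^ (j - 1)) * a = g s * (j * a ^ j) := by
    rw [← hpow1]
    ring
  have e4 : 4 * (j * (g' s * a ^ (j - 1))) * (a * s) = 4 * g' s * (j * a ^ j) * s := by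
    rw [← hpow1]
    ring
  rw [e1, e2, e3, e4]
  field_simp
  ring

/-- The function `g₀(‖x‖²) + g₁(‖x‖²) xₙ + g₂(‖x‖²) xₙ²`. -/
noncomputable def radialQuadratic (n : Fin N) (g₀ g₁ g₂ : ℝ → ℝ) (x : EuclideanSpace ℝ (Fin N)) : ℝ :=
  g₀ (‖x‖ ^ 2) + g₁ (‖x‖ ^ 2) * x n + g₂ (‖x‖ ^ 2) * x n ^ 2

lemma contDiffAt_radialQuadratic (n : Fin N) {g₀ g₁ g₂ : ℝ → ℝ}
    (h₀ : ContDiffOn ℝ 2 g₀ (Ioi 0)) (h₁ : ContDiffOn ℝ 2 g₁ (Ioi 0))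
    (h₂ : ContDiffOn ℝ 2 g₂ (Ioi 0)) {x : EuclideanSpace ℝ (Fin N)} (hx : x ≠ 0) :
    ContDiffAt ℝ 2 (radialQuadratic n g₀ g₁ g₂) x := by
  have := ((contDiffAt_radial_mul_coord_pow h₀ n 0 hx).add
    (contDiffAt_radial_mul_coord_pow h₁ n 1 hx)).add (contDiffAt_radial_mul_coord_pow h₂ n 2 hx)
  simp only [pow_zero, mul_one, pow_one] at this
  exact this

lemma divAgrad_radialQuadratic (k : ℝ) (n : Fin N) {g₀ g₀' g₀'' g₁ g₁' g₁'' g₂ g₂' g₂'' : ℝ → ℝ}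
    (h₀ : ContDiffOn ℝ 2 g₀ (Ioi 0)) (h₁ : ContDiffOn ℝ 2 g₁ (Ioi 0))
    (h₂ : ContDiffOn ℝ 2 g₂ (Ioi 0))
    (d₀ : ∀ s, 0 < s → HasDerivAt g₀ (g₀' s) s) (d₀' : ∀ s, 0 < s → HasDerivAt g₀' (g₀'' s) s)
    (d₁ : ∀ s, 0 < s → HasDerivAt g₁ (g₁' s) s) (d₁' : ∀ s, 0 < s → HasDerivAt g₁' (g₁'' s) s)
    (d₂ : ∀ s, 0 < s → HasDerivAt g₂ (g₂' s) s) (d₂' : ∀ s, 0 < s → HasDerivAt g₂' (g₂'' s) s)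
    {x : EuclideanSpace ℝ (Fin N)} (hx : x ≠ 0) :
    divAgrad (Amat k) (radialQuadratic n g₀ g₁ g₂) x =
      (4 * ‖x‖ ^ 2 * g₀'' (‖x‖ ^ 2) + 2 * N * g₀' (‖x‖ ^ 2))
      + x n * (4 * ‖x‖ ^ 2 * g₁'' (‖x‖ ^ 2) + (2 * N + 4) * g₁' (‖x‖ ^ 2)
        + (1 - k) * (N - 1) * g₁ (‖x‖ ^ 2) / ‖x‖ ^ 2)
      + x n ^ 2 * (4 * ‖x‖ ^ 2 * g₂'' (‖x‖ ^ 2) + (2 * N + 8) * g₂' (‖x‖ ^ 2)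
        + (1 - k) * 2 * N * g₂ (‖x‖ ^ 2) / ‖x‖ ^ 2)
      + 2 * k * g₂ (‖x‖ ^ 2) := by
  have c₀ := contDiffAt_radial_mul_coord_pow h₀ n 0 hx
  have c₁ := contDiffAt_radial_mul_coord_pow h₁ n 1 hx
  have c₂ := contDiffAt_radial_mul_coord_pow h₂ n 2 hx
  have e : radialQuadratic n g₀ g₁ g₂ = fun y => (g₀ (‖y‖ ^ 2) * y n ^ 0
      + g₁ (‖y‖ ^ 2) * y n ^ 1) + g₂ (‖y‖ ^ 2) * y n ^ 2 := by
    funext y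
    simp [radialQuadratic]
  rw [e, divAgrad_Amat_add k hx (c₀.add c₁) c₂, divAgrad_Amat_add k hx c₀ c₁,
    divAgrad_radial_mul_coord_pow k h₀ d₀ d₀' n 0 hx,
    divAgrad_radial_mul_coord_pow k h₁ d₁ d₁' n 1 hx,
    divAgrad_radial_mul_coord_pow k h₂ d₂ d₂' n 2 hx]
  push_cast
  simp only [pow_zero, pow_one]
  ring

end RadialPolynomials

section Comparison

open Filter Topology Set

variable {N : ℕ}

lemma le_of_divAgrad_lt {k : ℝ} (hk : 0 ≤ k) {u w : EuclideanSpace ℝ (Fin N) → ℝ}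
    {U Z D : Set (EuclideanSpace ℝ (Fin N))} (hU : IsOpen U) (hU0 : 0 ∉ U)
    (hu : ContDiffOn ℝ 2 u U) (hpos : ∀ x ∈ U, 0 < u x) (hZ : IsCompact Z)
    (hw : ∀ x ∈ Z, ContDiffAt ℝ 2 w x) (hD : IsOpen D) (hDZ : D ⊆ Z)
    (hwU : ∀ x ∈ Z, 0 < w x → x ∈ U) (hbd : ∀ x ∈ Z, x ∈ U → x ∉ D → w x ≤ u x)
    (hL : ∀ x ∈ D, x ∈ U → divAgrad (Amat k) u x < divAgrad (Amat k) w x) :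
    ∀ x ∈ Z, x ∈ U → w x ≤ u x := by
  intro x₀ hx₀ hx₀U
  by_contra! hlt
  have hwc : ContinuousOn w Z := fun x hx => (hw x hx).continuousAt.continuousWithinAt
  set η := w x₀ - u x₀ with hη
  have hη0 : 0 < η := sub_pos.mpr hlt
  have hK : IsCompact (Z ∩ w ⁻¹' Ici η) :=
    hZ.of_isClosed_subset (hwc.preimage_isClosed_of_isClosed hZ.isClosed isClosed_Ici)
      inter_subset_left
  have hKU : ∀ x ∈ Z ∩ w ⁻¹' Ici η, x ∈ U := fun x hx => hwU x hx.1 (hη0.trans_le hx.2)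
  have hvc : ContinuousOn (fun x => w x - 1 * u x) (Z ∩ w ⁻¹' Ici η) :=
    (hwc.mono inter_subset_left).sub (continuousOn_const.mul (hu.continuousOn.mono hKU))
  obtain ⟨x, hxK, hmax⟩ := hK.exists_isMaxOn
    ⟨x₀, hx₀, by have := hpos x₀ hx₀U; simp only [mem_preimage, mem_Ici]; linarith⟩ hvc
  have hxU := hKU x hxK
  have hge : η ≤ w x - u x := by
    have := hmax (a := x₀) ⟨hx₀, by
      have := hpos x₀ hx₀U; simp only [mem_preimage, mem_Ici]; linarith⟩
    simp only [mem_ofPred_eq, one_mul] at this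
    exact this
  have hxD : x ∈ D := by
    by_contra h
    have := hbd x hxK.1 hxU h
    linarith
  have hxw : η < w x := by
    have := hpos x hxU
    linarith
  have hloc : IsLocalMax (fun x => w x - 1 * u x) x := by
    filter_upwards [hD.mem_nhds hxD, (hw x hxK.1).continuousAt.eventually (lt_mem_nhds hxw)]
      with y hy hy'
    exact hmax ⟨hDZ hy, le_of_lt hy'⟩
  have hx0 : x ≠ 0 := fun h => hU0 (h ▸ hxU)
  have := divAgrad_le_of_isLocalMax_sub hk 1 hx0 (hu.contDiffAt (hU.mem_nhds hxU))
    (hw x hxK.1) hloc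
  linarith [hL x hxD hxU]

lemma isOpen_halfSpace_exterior (n : Fin N) (ρ : ℝ) :
    IsOpen {x : EuclideanSpace ℝ (Fin N) | 0 < x n ∧ ρ < ‖x‖} :=
  (isOpen_lt (by fun_prop) (by fun_prop)).and (isOpen_lt (by fun_prop) (by fun_prop))

lemma isCompact_slab (n : Fin N) (a b s t : ℝ) :
    IsCompact {x : EuclideanSpace ℝ (Fin N) | (a ≤ x n ∧ x n ≤ b) ∧ s ≤ ‖x‖ ^ 2 ∧ ‖x‖ ^ 2 ≤ t} := by
  refine (isCompact_closedBall (0 : EuclideanSpace ℝ (Fin N)) (t + 1)).of_isClosed_subset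
    (((isClosed_le (by fun_prop) (by fun_prop)).and
      (isClosed_le (by fun_prop) (by fun_prop))).and
    ((isClosed_le (by fun_prop) (by fun_prop)).and
      (isClosed_le (by fun_prop) (by fun_prop)))) ?_
  rintro x ⟨-, -, hx⟩
  rw [mem_closedBall_zero_iff]
  nlinarith [sq_nonneg (‖x‖ - 1)]

lemma coord_le_norm_sq_add_one (x : EuclideanSpace ℝ (Fin N)) (n : Fin N) :
    x n ≤ ‖x‖ ^ 2 + 1 := by
  nlinarith [coord_sq_le_norm_sq x n, sq_nonneg (x n - 1)]

/-- Comparison in an exterior half-space domain for subsolutions vanishing at infinity. -/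
lemma le_of_divAgrad_lt_exterior {k : ℝ} (hk : 0 ≤ k) (n : Fin N) {ρ s₁ : ℝ} (hρ : 0 < ρ)
    (hs₁ : ρ ^ 2 < s₁) {u w : EuclideanSpace ℝ (Fin N) → ℝ}
    (hu : ContDiffOn ℝ 2 u {x | 0 < x n ∧ ρ < ‖x‖})
    (hpos : ∀ x : EuclideanSpace ℝ (Fin N), 0 < x n → ρ < ‖x‖ → 0 < u x)
    (hw : ∀ x, x ≠ 0 → ContDiffAt ℝ 2 w x) (hw0 : ∀ x, x n = 0 → w x ≤ 0)
    (hin : ∀ x, 0 < x n → ‖x‖ ^ 2 = s₁ → w x ≤ u x)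
    {W : ℝ → ℝ} (hW : Tendsto W atTop (𝓝 0))
    (hwW : ∀ x, 0 ≤ x n → s₁ ≤ ‖x‖ ^ 2 → w x ≤ W (‖x‖ ^ 2))
    (hL : ∀ x, 0 < x n → s₁ < ‖x‖ ^ 2 → divAgrad (Amat k) u x < divAgrad (Amat k) w x) :
    ∀ x, 0 < x n → s₁ ≤ ‖x‖ ^ 2 → w x ≤ u x := by
  intro x₀ hx₀ hx₀s
  refine le_of_forall_pos_le_add fun δ hδ => ?_
  obtain ⟨S, hS, hSx⟩ := ((hW.eventually (gt_mem_nhds hδ)).and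
    (eventually_ge_atTop (‖x₀‖ ^ 2))).exists
  have hnorm (x : EuclideanSpace ℝ (Fin N)) (hx : s₁ ≤ ‖x‖ ^ 2) : ρ < ‖x‖ :=
    lt_of_pow_lt_pow_left₀ 2 (norm_nonneg x) (hs₁.trans_le hx)
  have key := le_of_divAgrad_lt hk (w := fun x => w x - δ) (isOpen_halfSpace_exterior n ρ)
    (by simp) hu (fun x hx => hpos x hx.1 hx.2) (isCompact_slab n 0 (S + 1) s₁ S)
    (D := {x | 0 < x n ∧ s₁ < ‖x‖ ^ 2 ∧ ‖x‖ ^ 2 < S})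
    (fun x hx => (hw x (norm_pos_iff.mp (hρ.trans (hnorm x hx.2.1)))).sub contDiffAt_const)
    ((isOpen_lt (by fun_prop) (by fun_prop)).and
      ((isOpen_lt (by fun_prop) (by fun_prop)).and (isOpen_lt (by fun_prop) (by fun_prop))))
    (fun x hx => ⟨⟨hx.1.le, by linarith [coord_le_norm_sq_add_one x n, hx.2.2]⟩,
      hx.2.1.le, hx.2.2.le⟩) ?_ ?_ ?_ x₀
    ⟨⟨hx₀.le, by linarith [coord_le_norm_sq_add_one x₀ n]⟩, hx₀s, hSx⟩ ⟨hx₀, hnorm x₀ hx₀s⟩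
  · linarith
  · intro x hx hwx
    refine ⟨hx.1.1.lt_of_ne fun h => ?_, hnorm x hx.2.1⟩
    have := hw0 x h.symm
    linarith
  · intro x hx hxU hxD
    rcases hx.2.1.eq_or_lt with h | h
    · linarith [hin x hxU.1 h.symm]
    · rcases hx.2.2.eq_or_lt with h' | h'
      · have := hwW x hx.1.1 hx.2.1
        rw [h'] at this
        linarith [hpos x hxU.1 hxU.2]
      · exact absurd ⟨hxU.1, h, h'⟩ hxD
  · intro x hx _
    have : divAgrad (Amat k) (fun x => w x - δ) x = divAgrad (Amat k) w x := by
      simp only [divAgrad, fderiv_sub_const]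
    rw [this]
    exact hL x hx.1 hx.2.1

/-- A Hopf-type lower bound: positive strict supersolutions grow at least linearly away from the
flat boundary. -/
lemma exists_pos_mul_coord_le {k : ℝ} (hk : 0 < k) (n : Fin N) {ρ s₀ : ℝ} (hρ : 0 < ρ)
    (hs₀ : ρ ^ 2 < s₀) {u : EuclideanSpace ℝ (Fin N) → ℝ}
    (hu : ContDiffOn ℝ 2 u {x | 0 < x n ∧ ρ < ‖x‖})
    (hpos : ∀ x : EuclideanSpace ℝ (Fin N), 0 < x n → ρ < ‖x‖ → 0 < u x)
    (hL : ∀ x : EuclideanSpace ℝ (Fin N), 0 < x n → ρ < ‖x‖ → divAgrad (Amat k) u x < 0) :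
    ∃ c, 0 < c ∧ ∀ x : EuclideanSpace ℝ (Fin N), 0 < x n → ‖x‖ ^ 2 = s₀ + 1 → c * x n ≤ u x := by
  have hs₀0 : 0 < s₀ := (sq_nonneg ρ).trans_lt hs₀
  have hN : (1 : ℝ) ≤ N := by exact_mod_cast n.pos
  have hnorm (x : EuclideanSpace ℝ (Fin N)) (hx : s₀ ≤ ‖x‖ ^ 2) : ρ < ‖x‖ :=
    lt_of_pow_lt_pow_left₀ 2 (norm_nonneg x) (hs₀.trans_le hx)
  set C₂ := |1 - k| * (2 * N) / s₀ with hC₂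
  set C₁ := 16 * (s₀ + 2) + (2 * N + 4) * 4 + C₂ with hC₁
  have hC₂0 : 0 ≤ C₂ := by positivity
  have hC₁0 : 0 ≤ C₁ := by positivity
  set a₀ := min (1 / 2) (k / (C₁ + C₂ + 1)) with ha₀
  have ha₀0 : 0 < a₀ := lt_min (by norm_num) (by positivity)
  have ha₀1 : a₀ ≤ 1 / 2 := min_le_left _ _
  have ha₀k : a₀ * (C₁ + C₂) ≤ k := by
    have h : a₀ * (C₁ + C₂ + 1) ≤ k := (le_div_iff₀ (by positivity)).mp (min_le_right _ _)
    linarith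
  obtain ⟨ε, hε, hεu⟩ : ∃ ε, 0 < ε ∧ ∀ x : EuclideanSpace ℝ (Fin N), a₀ ≤ x n → s₀ ≤ ‖x‖ ^ 2 →
      ‖x‖ ^ 2 ≤ s₀ + 2 → ε ≤ u x := by
    have hsub : ∀ x ∈ {x : EuclideanSpace ℝ (Fin N) | (a₀ ≤ x n ∧ x n ≤ s₀ + 3) ∧
        s₀ ≤ ‖x‖ ^ 2 ∧ ‖x‖ ^ 2 ≤ s₀ + 2}, 0 < x n ∧ ρ < ‖x‖ :=
      fun x hx => ⟨ha₀0.trans_le hx.1.1, hnorm x hx.2.1⟩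
    obtain ⟨ε, hε, h⟩ := (isCompact_slab n a₀ (s₀ + 3) s₀ (s₀ + 2)).exists_forall_le'
      (hu.continuousOn.mono hsub) (a := 0) (fun x hx => hpos x (hsub x hx).1 (hsub x hx).2)
    exact ⟨ε, hε, fun x h1 h2 h3 =>
      h x ⟨⟨h1, by linarith [coord_le_norm_sq_add_one x n]⟩, h2, h3⟩⟩
  set g₁ : ℝ → ℝ := fun s => ε / 2 * (1 - 2 * (s - (s₀ + 1)) ^ 2) with hg₁
  have key := le_of_divAgrad_lt hk.le
    (w := radialQuadratic n (fun _ => 0) g₁ (fun _ => ε / 2)) (isOpen_halfSpace_exterior n ρ)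
    (by simp) hu (fun x hx => hpos x hx.1 hx.2) (isCompact_slab n 0 a₀ s₀ (s₀ + 2))
    (D := {x | (0 < x n ∧ x n < a₀) ∧ s₀ < ‖x‖ ^ 2 ∧ ‖x‖ ^ 2 < s₀ + 2})
    (fun x hx => contDiffAt_radialQuadratic n contDiffOn_const (by fun_prop) contDiffOn_const
      (norm_pos_iff.mp (hρ.trans (hnorm x hx.2.1))))
    (((isOpen_lt (by fun_prop) (by fun_prop)).and (isOpen_lt (by fun_prop) (by fun_prop))).and
      ((isOpen_lt (by fun_prop) (by fun_prop)).and (isOpen_lt (by fun_prop) (by fun_prop))))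
    (fun x hx => ⟨⟨hx.1.1.le, hx.1.2.le⟩, hx.2.1.le, hx.2.2.le⟩) ?_ ?_ ?_
  · refine ⟨ε / 2 / (s₀ + 2), by positivity, fun x hx hxs => ?_⟩
    have hle : x n ≤ s₀ + 2 := by linarith [coord_le_norm_sq_add_one x n]
    rcases le_total (x n) a₀ with h | h
    · have := key x ⟨⟨hx.le, h⟩, by linarith, by linarith⟩ ⟨hx, hnorm x (by linarith)⟩
      simp only [radialQuadratic, hg₁, hxs] at this
      have h1 : ε / 2 / (s₀ + 2) * x n ≤ ε / 2 * x n :=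
        mul_le_mul_of_nonneg_right (div_le_self (by positivity) (by linarith)) hx.le
      have h2 : 0 ≤ ε / 2 * x n ^ 2 := by positivity
      nlinarith
    · have h1 : ε / 2 / (s₀ + 2) * x n ≤ ε / 2 := by
        rw [div_mul_eq_mul_div, div_le_iff₀ (by positivity)]
        exact mul_le_mul_of_nonneg_left hle (by positivity)
      linarith [hεu x h (by linarith) (by linarith)]
  · intro x hx hwx
    refine ⟨hx.1.1.lt_of_ne fun h => ?_, hnorm x hx.2.1⟩
    simp [radialQuadratic, ← h] at hwx
  · intro x hx hxU hxD
    have hbdry : ‖x‖ ^ 2 = s₀ ∨ ‖x‖ ^ 2 = s₀ + 2 → radialQuadratic n (fun _ => 0) g₁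
        (fun _ => ε / 2) x ≤ 0 := by
      intro h
      have hg : g₁ (‖x‖ ^ 2) = -(ε / 2) := by
        rcases h with h | h <;> simp only [hg₁, h] <;> ring
      simp only [radialQuadratic, hg]
      have : 0 ≤ ε / 2 * x n * (1 - x n) :=
        mul_nonneg (mul_nonneg (by positivity) hx.1.1) (by linarith [hx.1.2])
      linarith
    rcases hx.2.1.eq_or_lt with h | h
    · exact (hbdry (Or.inl h.symm)).trans (hpos x hxU.1 hxU.2).le
    rcases hx.2.2.eq_or_lt with h' | h'
    · exact (hbdry (Or.inr h')).trans (hpos x hxU.1 hxU.2).le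
    rcases hx.1.2.eq_or_lt with h'' | h''
    · refine le_trans ?_ (hεu x h''.ge h.le h'.le)
      have hg : g₁ (‖x‖ ^ 2) ≤ ε / 2 := by
        simp only [hg₁]
        nlinarith [sq_nonneg (‖x‖ ^ 2 - (s₀ + 1))]
      simp only [radialQuadratic]
      have h1 : g₁ (‖x‖ ^ 2) * x n ≤ ε / 2 * x n := mul_le_mul_of_nonneg_right hg hx.1.1
      have h2 : ε / 2 * x n ≤ ε / 2 * 1 := by gcongr; linarith
      have h3 : ε / 2 * x n ^ 2 ≤ ε / 2 * 1 := by gcongr; nlinarith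
      linarith
    · exact absurd ⟨⟨hxU.1, h''⟩, h, h'⟩ hxD
  · rintro x ⟨⟨hx1, hx2⟩, hx3, hx4⟩ hxU
    refine (hL x hxU.1 hxU.2).trans_le ?_
    rw [divAgrad_radialQuadratic k n (g₀' := fun _ => 0) (g₀'' := fun _ => 0)
      (g₁' := fun s => ε / 2 * (-4 * (s - (s₀ + 1)))) (g₁'' := fun _ => ε / 2 * -4)
      (g₂' := fun _ => 0) (g₂'' := fun _ => 0) contDiffOn_const (by fun_prop) contDiffOn_const
      (fun s _ => hasDerivAt_const s _) (fun s _ => hasDerivAt_const s _)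
      (fun s _ => ?_) (fun s _ => ?_)
      (fun s _ => hasDerivAt_const s _) (fun s _ => hasDerivAt_const s _)
      (norm_pos_iff.mp (hρ.trans hxU.2))]
    · simp only [hg₁]
      set s := ‖x‖ ^ 2
      set a := x n
      have hs : 0 < s := hs₀0.trans hx3
      have hf : |1 - 2 * (s - (s₀ + 1)) ^ 2| ≤ 1 := by
        rw [abs_le]
        constructor <;> nlinarith
      have hfrac : (1 - k) * (2 * N) / s ≥ -C₂ := by
        have : |(1 - k) * (2 * N) / s| ≤ C₂ := by
          rw [abs_div, abs_mul, abs_of_pos hs, abs_of_pos (by linarith : (0 : ℝ) < 2 * N), hC₂]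
          gcongr
        exact (abs_le.mp this).1
      have hfrac' : (1 - k) * (N - 1) * (1 - 2 * (s - (s₀ + 1)) ^ 2) / s ≥ -C₂ := by
        have : |(1 - k) * (N - 1) * (1 - 2 * (s - (s₀ + 1)) ^ 2) / s| ≤ C₂ := by
          rw [abs_div, abs_mul, abs_mul, abs_of_pos hs,
            abs_of_nonneg (by linarith : (0 : ℝ) ≤ N - 1), hC₂]
          have h1 : |1 - k| * (N - 1) * |1 - 2 * (s - (s₀ + 1)) ^ 2| ≤ |1 - k| * (2 * N) * 1 := by
            gcongr
            linarith
          rw [mul_one] at h1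
          gcongr
        exact (abs_le.mp this).1
      have hb : -C₁ ≤ 4 * s * -4 + (2 * N + 4) * (-4 * (s - (s₀ + 1)))
          + (1 - k) * (N - 1) * (1 - 2 * (s - (s₀ + 1)) ^ 2) / s := by
        have : (2 * N + 4) * (4 * (s - (s₀ + 1))) ≤ (2 * N + 4) * 4 :=
          mul_le_mul_of_nonneg_left (by linarith) (by positivity)
        linarith
      have h1 := mul_le_mul_of_nonneg_left hb hx1.le
      have h2 := mul_le_mul_of_nonneg_left hfrac (sq_nonneg a)
      have h3 : a * C₁ ≤ a₀ * C₁ := mul_le_mul_of_nonneg_right hx2.le hC₁0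
      have h4 : a ^ 2 * C₂ ≤ a₀ * C₂ := mul_le_mul_of_nonneg_right (by nlinarith) hC₂0
      have h5 : 0 ≤ ε / 2 * (a * (4 * s * -4 + (2 * N + 4) * (-4 * (s - (s₀ + 1)))
          + (1 - k) * (N - 1) * (1 - 2 * (s - (s₀ + 1)) ^ 2) / s)
          + a ^ 2 * ((1 - k) * (2 * N) / s) + 2 * k) :=
        mul_nonneg (by positivity) (by linarith)
      refine h5.trans_eq ?_
      field_simp
      ring
    · simp only [hg₁]
      have := (((((hasDerivAt_id s).sub_const (s₀ + 1)).pow 2).const_mul 2).const_sub 1).const_mul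
        (ε / 2)
      refine this.congr_deriv ?_
      simp only [id]
      push_cast
      ring
    · have := (((hasDerivAt_id s).sub_const (s₀ + 1)).const_mul (-4)).const_mul (ε / 2)
      refine this.congr_deriv ?_
      ring

end Comparison

section LogBarrier

open Filter Topology Set Real

variable {N : ℕ}

lemma hasDerivAt_rpow_mul_log (m A B l : ℝ) {s : ℝ} (hs : 0 < s) :
    HasDerivAt (fun s => s ^ m * (A * (log s - l) + B))
      (s ^ (m - 1) * (m * A * (log s - l) + (m * B + A))) s := by
  have h := (Real.hasDerivAt_rpow_const (p := m) (Or.inl hs.ne')).mul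
    ((((Real.hasDerivAt_log hs.ne').sub_const l).const_mul A).add_const B)
  refine h.congr_deriv ?_
  rw [Real.rpow_sub_one hs.ne']
  ring

lemma contDiffOn_rpow_mul_log (m A B l : ℝ) :
    ContDiffOn ℝ 2 (fun s : ℝ => s ^ m * (A * (log s - l) + B)) (Ioi 0) := by
  intro s hs
  have hs' : s ≠ 0 := (mem_Ioi.mp hs).ne'
  exact ((Real.contDiffAt_rpow_const_of_ne hs').mul
    ((contDiffAt_const.mul ((Real.contDiffAt_log.mpr hs').sub contDiffAt_const)).add
      contDiffAt_const)).contDiffWithinAt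

/-- The barrier `|x|^(α-1) x_n (A (log |x|² - l) + B) + C |x|^(α-2) x_n²`. -/
noncomputable def logBarrier (n : Fin N) (α A B C l : ℝ) : EuclideanSpace ℝ (Fin N) → ℝ :=
  radialQuadratic n (fun _ => 0) (fun s => s ^ ((α - 1) / 2) * (A * (log s - l) + B))
    (fun s => s ^ (α / 2 - 1) * (0 * (log s - l) + C))

lemma contDiffAt_logBarrier (n : Fin N) (α A B C l : ℝ) {x : EuclideanSpace ℝ (Fin N)}
    (hx : x ≠ 0) : ContDiffAt ℝ 2 (logBarrier n α A B C l) x :=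
  contDiffAt_radialQuadratic n contDiffOn_const (contDiffOn_rpow_mul_log _ _ _ _)
    (contDiffOn_rpow_mul_log _ _ _ _) hx

lemma rpow_mul_coord_eq {s : ℝ} (hs : 0 < s) (α a : ℝ) :
    s ^ ((α - 1) / 2) * a = s ^ (α / 2) * (a / √s) := by
  rw [show (α - 1) / 2 = α / 2 - 1 / 2 by ring, Real.rpow_sub hs, ← Real.sqrt_eq_rpow]
  ring

lemma logBarrier_apply (n : Fin N) (α A B C l : ℝ) {x : EuclideanSpace ℝ (Fin N)} (hx : x ≠ 0) :
    logBarrier n α A B C l x = (‖x‖ ^ 2) ^ (α / 2) *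
      (x n / √(‖x‖ ^ 2) * (A * (log (‖x‖ ^ 2) - l) + B) + C * (x n / √(‖x‖ ^ 2)) ^ 2) := by
  have hs : 0 < ‖x‖ ^ 2 := by positivity
  simp only [logBarrier, radialQuadratic]
  rw [Real.rpow_sub_one hs.ne', div_pow, Real.sq_sqrt hs.le]
  linear_combination (A * (log (‖x‖ ^ 2) - l) + B) * rpow_mul_coord_eq hs α (x n)

lemma divAgrad_logBarrier {k α : ℝ} (hkα : k * (N - 1) = α * (α + N - 2)) (n : Fin N)
    (A B C l : ℝ) {x : EuclideanSpace ℝ (Fin N)} (hx : x ≠ 0) :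
    divAgrad (Amat k) (logBarrier n α A B C l) x = (‖x‖ ^ 2) ^ (α / 2 - 1) *
      (2 * A * (2 * α + N - 2) * (x n / √(‖x‖ ^ 2))
        + C * k * (2 - (N + 1) * (x n / √(‖x‖ ^ 2)) ^ 2)) := by
  have hs : 0 < ‖x‖ ^ 2 := by positivity
  rw [logBarrier, divAgrad_radialQuadratic k n (g₀' := fun _ => 0) (g₀'' := fun _ => 0)
    contDiffOn_const (contDiffOn_rpow_mul_log _ _ _ _) (contDiffOn_rpow_mul_log _ _ _ _)
    (fun s _ => hasDerivAt_const s _) (fun s _ => hasDerivAt_const s _)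
    (fun s hs => hasDerivAt_rpow_mul_log _ _ _ _ hs) (fun s hs => hasDerivAt_rpow_mul_log _ _ _ _ hs)
    (fun s hs => hasDerivAt_rpow_mul_log _ _ _ _ hs) (fun s hs => hasDerivAt_rpow_mul_log _ _ _ _ hs)
    hx]
  set s := ‖x‖ ^ 2
  set a := x n
  have e : s ^ (α / 2 - 1) * (a / √s) = s ^ ((α - 1) / 2 - 1) * a := by
    have := rpow_mul_coord_eq hs (α - 2) a
    rw [show (α - 2) / 2 = α / 2 - 1 by ring] at this
    rw [← this]
    ring_nf
  have e2 : (a / √s) ^ 2 = a ^ 2 / s := by rw [div_pow, Real.sq_sqrt hs.le]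
  have e3 : s ^ (α / 2 - 1) * (2 * A * (2 * α + N - 2) * (a / √s)
        + C * k * (2 - (N + 1) * (a / √s) ^ 2)) =
      2 * A * (2 * α + N - 2) * (s ^ ((α - 1) / 2 - 1) * a) +
        s ^ (α / 2 - 1) * (C * k * (2 - (N + 1) * (a ^ 2 / s))) := by
    rw [← e, ← e2]
    ring
  rw [e3, Real.rpow_sub_one hs.ne' ((α - 1) / 2 - 1), Real.rpow_sub_one hs.ne' (α / 2 - 1 - 1),
    Real.rpow_sub_one hs.ne' ((α - 1) / 2), Real.rpow_sub_one hs.ne' (α / 2 - 1)]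
  set P := s ^ ((α - 1) / 2)
  set Q := s ^ (α / 2 - 1)
  set L := log s - l
  field_simp
  linear_combination (-4 * (P * a * (A * L + B) + Q * a ^ 2 * C)) * hkα

lemma coord_div_sqrt_le_one (x : EuclideanSpace ℝ (Fin N)) (n : Fin N) :
    x n / √(‖x‖ ^ 2) ≤ 1 := by
  rw [Real.sqrt_sq (norm_nonneg x)]
  exact div_le_one_of_le₀ (abs_le_of_sq_le_sq' (coord_sq_le_norm_sq x n) (norm_nonneg x)).2
    (norm_nonneg x)

lemma tendsto_rpow_mul_log_atTop {ν : ℝ} (hν : ν < 0) (A B l : ℝ) :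
    Tendsto (fun s : ℝ => s ^ ν * (A * (log s - l) + B)) atTop (𝓝 0) := by
  have h1 : Tendsto (fun s : ℝ => s ^ ν) atTop (𝓝 0) := by
    simpa using tendsto_rpow_neg_atTop (neg_pos.mpr hν)
  have h2 : Tendsto (fun s : ℝ => log s * s ^ ν) atTop (𝓝 0) := by
    have := (isLittleO_log_rpow_atTop (neg_pos.mpr hν)).tendsto_div_nhds_zero
    refine this.congr' ?_
    filter_upwards [eventually_gt_atTop 0] with s hs
    rw [Real.rpow_neg hs.le, div_inv_eq_mul]
  have := (h2.const_mul A).add (h1.mul_const (B - A * l))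
  simp only [mul_zero, zero_mul, add_zero] at this
  refine this.congr fun s => ?_
  ring

lemma logBarrier_le {k α : ℝ} (hk : 0 ≤ k) (hα : α < 0) (n : Fin N) {ρ s₁ : ℝ} (hρ : 0 < ρ)
    (hs₁ : ρ ^ 2 < s₁) {u : EuclideanSpace ℝ (Fin N) → ℝ}
    (hu : ContDiffOn ℝ 2 u {x | 0 < x n ∧ ρ < ‖x‖})
    (hpos : ∀ x : EuclideanSpace ℝ (Fin N), 0 < x n → ρ < ‖x‖ → 0 < u x) {A B C : ℝ}
    (hA : 0 ≤ A) (hB : 0 ≤ B) (hC : 0 ≤ C)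
    (hin : ∀ x : EuclideanSpace ℝ (Fin N), 0 < x n → ‖x‖ ^ 2 = s₁ →
      s₁ ^ (α / 2) * (x n / √s₁) * (B + C) ≤ u x)
    (hL : ∀ x : EuclideanSpace ℝ (Fin N), 0 < x n → s₁ < ‖x‖ ^ 2 →
      divAgrad (Amat k) u x < divAgrad (Amat k) (logBarrier n α A B C (log s₁)) x) :
    ∀ x : EuclideanSpace ℝ (Fin N), 0 < x n → s₁ ≤ ‖x‖ ^ 2 →
      (‖x‖ ^ 2) ^ (α / 2) * (x n / √(‖x‖ ^ 2)) * (A * (log (‖x‖ ^ 2) - log s₁) + B) ≤ u x := by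
  have hs₁0 : 0 < s₁ := (sq_nonneg ρ).trans_lt hs₁
  have hne (x : EuclideanSpace ℝ (Fin N)) (hx : s₁ ≤ ‖x‖ ^ 2) : x ≠ 0 := by
    rintro rfl
    simp at hx
    linarith
  have key := le_of_divAgrad_lt_exterior hk n hρ hs₁ hu hpos
    (w := logBarrier n α A B C (log s₁)) (fun x hx => contDiffAt_logBarrier n _ _ _ _ _ hx)
    (fun x hx => by simp [logBarrier, radialQuadratic, hx]) ?_
    (tendsto_rpow_mul_log_atTop (show α / 2 < 0 by linarith) A (B + C) (log s₁)) ?_ hL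
  · intro x hx hxs
    refine le_trans ?_ (key x hx hxs)
    rw [logBarrier_apply n _ _ _ _ _ (hne x hxs), mul_assoc]
    refine mul_le_mul_of_nonneg_left ?_ (by positivity)
    exact le_add_of_nonneg_right (by positivity)
  · intro x hx hxs
    refine le_trans ?_ (hin x hx hxs)
    rw [logBarrier_apply n _ _ _ _ _ (hne x hxs.ge), mul_assoc, hxs]
    have h1 := coord_div_sqrt_le_one x n
    rw [hxs] at h1
    have h0 : 0 ≤ x n / √s₁ := by positivity
    refine mul_le_mul_of_nonneg_left ?_ (by positivity)
    have h2 : C * (x n / √s₁) ^ 2 ≤ C * (x n / √s₁) :=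
      mul_le_mul_of_nonneg_left (by nlinarith) hC
    rw [sub_self, mul_zero, zero_add]
    linarith
  · intro x hx hxs
    rw [logBarrier_apply n _ _ _ _ _ (hne x hxs)]
    have h1 := coord_div_sqrt_le_one x n
    have h0 : 0 ≤ x n / √(‖x‖ ^ 2) := by positivity
    have hlog : 0 ≤ log (‖x‖ ^ 2) - log s₁ := sub_nonneg.mpr (Real.log_le_log hs₁0 hxs)
    refine mul_le_mul_of_nonneg_left ?_ (by positivity)
    have h2 : x n / √(‖x‖ ^ 2) * (A * (log (‖x‖ ^ 2) - log s₁) + B) ≤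
      A * (log (‖x‖ ^ 2) - log s₁) + B := mul_le_of_le_one_left (by positivity) h1
    have h3 : C * (x n / √(‖x‖ ^ 2)) ^ 2 ≤ C := mul_le_of_le_one_right hC (pow_le_one₀ h0 h1)
    linarith

end LogBarrier

section Nonexistence

open Filter Topology Set Real

variable {N : ℕ}

/-- Positive supersolutions of `-div(A∇u) = u^q` are bounded below by a multiple of
`|x|^(α-1) x_n log |x|`. -/
lemma exists_log_lower_bound {k α γ q : ℝ} (hk : 0 < k) (hα : α < 0) (hγ : 0 < γ)
    (hγα : γ = 2 - N - 2 * α) (hkα : k * (N - 1) = α * (α + N - 2)) (hq : 0 < q)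
    (hqα : α / 2 - 1 ≤ α / 2 * q) (n : Fin N) {ρ : ℝ} (hρ : 0 < ρ)
    {u : EuclideanSpace ℝ (Fin N) → ℝ}
    (hu : ContDiffOn ℝ 2 u {x | 0 < x n ∧ ρ < ‖x‖})
    (hpos : ∀ x : EuclideanSpace ℝ (Fin N), 0 < x n → ρ < ‖x‖ → 0 < u x)
    (hsuper : ∀ x : EuclideanSpace ℝ (Fin N), 0 < x n → ρ < ‖x‖ →
      divAgrad (Amat k) u x ≤ -u x ^ q) :
    ∃ c s₁ : ℝ, 0 < c ∧ 1 ≤ s₁ ∧ ρ ^ 2 < s₁ ∧ ∀ x : EuclideanSpace ℝ (Fin N), 0 < x n →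
      s₁ ≤ ‖x‖ ^ 2 →
      (‖x‖ ^ 2) ^ (α / 2) * (x n / √(‖x‖ ^ 2)) * (c * (log (‖x‖ ^ 2) - log s₁)) ≤ u x := by
  have hN : (1 : ℝ) ≤ N := by exact_mod_cast n.pos
  have hneg (x : EuclideanSpace ℝ (Fin N)) (h1 : 0 < x n) (h2 : ρ < ‖x‖) :
      divAgrad (Amat k) u x < 0 :=
    (hsuper x h1 h2).trans_lt (neg_neg_of_pos (Real.rpow_pos_of_pos (hpos x h1 h2) q))
  obtain ⟨c₀, hc₀, hopf⟩ := exists_pos_mul_coord_le hk n (s₀ := (ρ + 1) ^ 2) hρ (by nlinarith)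
    hu hpos hneg
  set s₁ := (ρ + 1) ^ 2 + 1 with hs₁
  have hs₁1 : 1 ≤ s₁ := by nlinarith
  have hs₁ρ : ρ ^ 2 < s₁ := by nlinarith
  have hs₁0 : 0 < s₁ := by linarith
  have hnorm (x : EuclideanSpace ℝ (Fin N)) (hx : s₁ ≤ ‖x‖ ^ 2) : ρ < ‖x‖ :=
    lt_of_pow_lt_pow_left₀ 2 (norm_nonneg x) (hs₁ρ.trans_le hx)
  have hne (x : EuclideanSpace ℝ (Fin N)) (hx : s₁ ≤ ‖x‖ ^ 2) : x ≠ 0 :=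
    norm_pos_iff.mp (hρ.trans (hnorm x hx))
  set B := c₀ * √s₁ / s₁ ^ (α / 2) with hB
  have hB0 : 0 < B := by positivity
  have hlow : ∀ x : EuclideanSpace ℝ (Fin N), 0 < x n → s₁ ≤ ‖x‖ ^ 2 →
      (‖x‖ ^ 2) ^ (α / 2) * (x n / √(‖x‖ ^ 2)) * B ≤ u x := by
    have := logBarrier_le hk.le hα n hρ hs₁ρ hu hpos (A := 0) (B := B) (C := 0) le_rfl hB0.le
      le_rfl (fun x hx hxs => ?_) (fun x hx hxs => ?_)
    · simpa using this
    · refine le_trans (le_of_eq ?_) (hopf x hx hxs)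
      have h1 : √s₁ ≠ 0 := by positivity
      have h2 : s₁ ^ (α / 2) ≠ 0 := by positivity
      rw [hB]
      field_simp
      ring
    · rw [divAgrad_logBarrier hkα n _ _ _ _ (hne x hxs.le)]
      simpa using hneg x hx (hnorm x hxs.le)
  set δ := B / (N + 1) with hδ
  have hδ0 : 0 < δ := by positivity
  set c := min (B * k / (2 * γ)) (δ ^ q / (4 * γ * N)) with hc
  have hc0 : 0 < c := lt_min (by positivity) (by positivity)
  have hcB : 2 * γ * c / k ≤ B := by
    have : c * (2 * γ) ≤ B * k := (le_div_iff₀ (by positivity)).mp (min_le_left _ _)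
    rw [div_le_iff₀ hk]
    linarith
  have hcδ : 2 * γ * c * N < δ ^ q := by
    have : c * (4 * γ * N) ≤ δ ^ q := (le_div_iff₀ (by positivity)).mp (min_le_right _ _)
    have : 0 < δ ^ q := by positivity
    linarith
  refine ⟨c, s₁, hc0, hs₁1, hs₁ρ, ?_⟩
  have := logBarrier_le hk.le hα n hρ hs₁ρ hu hpos (A := c) (B := 0) (C := 2 * γ * c / k) hc0.le
    le_rfl (by positivity) (fun x hx hxs => ?_) (fun x hx hxs => ?_)
  · simpa using this
  · have h1 := hlow x hx hxs.ge
    rw [hxs] at h1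
    refine le_trans ?_ h1
    rw [zero_add]
    exact mul_le_mul_of_nonneg_left hcB (by positivity)
  · rw [divAgrad_logBarrier hkα n _ _ _ _ (hne x hxs.le)]
    have hs1 : 1 ≤ ‖x‖ ^ 2 := hs₁1.trans hxs.le
    have ht1 := coord_div_sqrt_le_one x n
    have hlowx := hlow x hx hxs.le
    set s := ‖x‖ ^ 2
    have hs0 : 0 < s := by linarith
    have ht0 : 0 < x n / √s := by positivity
    set t := x n / √s
    have e : s ^ (α / 2 - 1) * (2 * c * (2 * α + N - 2) * t
        + 2 * γ * c / k * k * (2 - (N + 1) * t ^ 2)) =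
        s ^ (α / 2 - 1) * (2 * γ * c * (2 - t - (N + 1) * t ^ 2)) := by
      rw [div_mul_cancel₀ _ hk.ne', hγα]
      ring
    rw [e]
    rcases le_total ((N + 1) * t ^ 2) 1 with ht | ht
    · refine (hneg x hx (hnorm x hxs.le)).trans_le ?_
      have : 0 ≤ 2 - t - (N + 1) * t ^ 2 := by linarith
      positivity
    · have htN : 1 ≤ (N + 1) * t := ht.trans (mul_le_mul_of_nonneg_left (by nlinarith) (by linarith))
      have h1 : s ^ (α / 2) * δ ≤ u x := by
        refine le_trans ?_ hlowx
        rw [mul_assoc]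
        refine mul_le_mul_of_nonneg_left ?_ (by positivity)
        rw [hδ, div_le_iff₀ (by positivity)]
        nlinarith
      have h2 : s ^ (α / 2 - 1) * δ ^ q ≤ u x ^ q := by
        refine le_trans ?_ (Real.rpow_le_rpow (by positivity) h1 hq.le)
        rw [Real.mul_rpow (by positivity) hδ0.le, ← Real.rpow_mul hs0.le]
        exact mul_le_mul_of_nonneg_right (Real.rpow_le_rpow_of_exponent_le hs1 hqα) (by positivity)
      have h3 : 2 * γ * c * -N ≤ 2 * γ * c * (2 - t - (N + 1) * t ^ 2) := by
        refine mul_le_mul_of_nonneg_left ?_ (by positivity)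
        have : (N + 1) * t ^ 2 ≤ (N + 1) * 1 := by
          gcongr
          exact pow_le_one₀ ht0.le ht1
        linarith
      have h4 : 0 < s ^ (α / 2 - 1) := by positivity
      have h5 := mul_le_mul_of_nonneg_left h3 h4.le
      have h6 := mul_lt_mul_of_pos_left hcδ h4
      have h7 := hsuper x hx (hnorm x hxs.le)
      linarith

/-- A Barta-type estimate on dyadic regions away from the flat boundary. -/
lemma exists_neg_div_mul_le_divAgrad {k : ℝ} (hk : 0 ≤ k) (hN : 2 ≤ N) (n : Fin N) {ρ S : ℝ}
    (hρ : 0 < ρ) (hS : ρ ^ 2 < S) {u : EuclideanSpace ℝ (Fin N) → ℝ}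
    (hu : ContDiffOn ℝ 2 u {x | 0 < x n ∧ ρ < ‖x‖})
    (hpos : ∀ x : EuclideanSpace ℝ (Fin N), 0 < x n → ρ < ‖x‖ → 0 < u x) :
    ∃ x : EuclideanSpace ℝ (Fin N), 0 < x n ∧ S < ‖x‖ ^ 2 ∧ ‖x‖ ^ 2 < N * x n ^ 2 ∧
      -((8 * (N + 8) ^ 2 + 2 * N * k) / ‖x‖ ^ 2) * u x ≤ divAgrad (Amat k) u x := by
  have hN' : (2 : ℝ) ≤ N := by exact_mod_cast hN
  have hS0 : 0 < S := (sq_nonneg ρ).trans_lt hS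
  have hnorm (x : EuclideanSpace ℝ (Fin N)) (hx : S ≤ ‖x‖ ^ 2) : ρ < ‖x‖ :=
    lt_of_pow_lt_pow_left₀ 2 (norm_nonneg x) (hS.trans_le hx)
  set U := {x : EuclideanSpace ℝ (Fin N) | 0 < x n ∧ ρ < ‖x‖}
  have hU : IsOpen U := isOpen_halfSpace_exterior n ρ
  set b : ℝ → ℝ := fun s => (s - S) * (4 * S - s) with hb
  set ψ : EuclideanSpace ℝ (Fin N) → ℝ :=
    radialQuadratic n (fun s => -(s * b s ^ 2) / N) (fun _ => 0) (fun s => b s ^ 2) with hψ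
  have hψ_apply (x : EuclideanSpace ℝ (Fin N)) :
      ψ x = b (‖x‖ ^ 2) ^ 2 * (x n ^ 2 - ‖x‖ ^ 2 / N) := by
    simp only [hψ, radialQuadratic]
    ring
  have hψ_diff {x : EuclideanSpace ℝ (Fin N)} (hx : x ≠ 0) : ContDiffAt ℝ 2 ψ x :=
    contDiffAt_radialQuadratic n (by fun_prop) contDiffOn_const (by fun_prop) hx
  set Z := {x : EuclideanSpace ℝ (Fin N) | (0 ≤ x n ∧ x n ≤ 4 * S + 1) ∧ S ≤ ‖x‖ ^ 2 ∧
    ‖x‖ ^ 2 ≤ 4 * S} ∩ {x | ‖x‖ ^ 2 ≤ N * x n ^ 2} with hZ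
  have hZc : IsCompact Z :=
    (isCompact_slab n _ _ _ _).inter_right (isClosed_le (by fun_prop) (by fun_prop))
  have hZU : ∀ x ∈ Z, x ∈ U := by
    rintro x ⟨⟨⟨h1, -⟩, h2, -⟩, h3⟩
    refine ⟨h1.lt_of_ne fun h => ?_, hnorm x h2⟩
    have h3' : ‖x‖ ^ 2 ≤ N * x n ^ 2 := h3
    rw [← h] at h3'
    simp only [ne_eq, OfNat.ofNat_ne_zero, not_false_eq_true, zero_pow, mul_zero] at h3'
    linarith
  set D := {x : EuclideanSpace ℝ (Fin N) | (0 < x n ∧ S < ‖x‖ ^ 2) ∧ ‖x‖ ^ 2 < 4 * S ∧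
    ‖x‖ ^ 2 < N * x n ^ 2}
  have hDo : IsOpen D :=
    ((isOpen_lt (by fun_prop) (by fun_prop)).and (isOpen_lt (by fun_prop) (by fun_prop))).and
      ((isOpen_lt (by fun_prop) (by fun_prop)).and (isOpen_lt (by fun_prop) (by fun_prop)))
  have hDZ : D ⊆ Z := fun x hx => ⟨⟨⟨hx.1.1.le, by linarith [coord_le_norm_sq_add_one x n, hx.2.1]⟩,
    hx.1.2.le, hx.2.1.le⟩, hx.2.2.le⟩
  have hψD : ∀ x ∈ D, 0 < ψ x := by
    intro x hx
    rw [hψ_apply]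
    have h1 : 0 < b (‖x‖ ^ 2) := mul_pos (sub_pos.mpr hx.1.2) (sub_pos.mpr hx.2.1)
    have h2 : ‖x‖ ^ 2 / N < x n ^ 2 := by
      rw [div_lt_iff₀ (by linarith), mul_comm]
      exact hx.2.2
    have := sub_pos.mpr h2
    positivity
  have hx₀ : EuclideanSpace.single n (√(2 * S)) ∈ D := by
    have h1 : ‖EuclideanSpace.single n (√(2 * S))‖ ^ 2 = 2 * S := by
      rw [PiLp.norm_single, Real.norm_eq_abs, sq_abs, Real.sq_sqrt (by positivity)]
    have h2 : (EuclideanSpace.single n (√(2 * S)) : EuclideanSpace ℝ (Fin N)) n = √(2 * S) := by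
      simp
    refine ⟨⟨?_, ?_⟩, ?_, ?_⟩
    · rw [h2]
      positivity
    · rw [h1]
      linarith
    · rw [h1]
      linarith
    · rw [h1, h2, Real.sq_sqrt (by positivity)]
      nlinarith
  obtain ⟨x, hxZ, hmax⟩ := hZc.exists_isMaxOn (f := fun x => ψ x / u x) ⟨_, hDZ hx₀⟩
    (ContinuousOn.div (fun y hy => (hψ_diff (norm_pos_iff.mp
      (hρ.trans (hZU y hy).2))).continuousAt.continuousWithinAt) (hu.continuousOn.mono hZU)
      fun y hy => (hpos y (hZU y hy).1 (hZU y hy).2).ne')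
  have hxU := hZU x hxZ
  have hux : 0 < u x := hpos x hxU.1 hxU.2
  have hx0 : x ≠ 0 := norm_pos_iff.mp (hρ.trans hxU.2)
  have hτ : 0 < ψ x / u x :=
    (div_pos (hψD _ hx₀) (hpos _ (hZU _ (hDZ hx₀)).1 (hZU _ (hDZ hx₀)).2)).trans_le
      (hmax (hDZ hx₀))
  have hψx : 0 < ψ x := by
    have := mul_pos hτ hux
    rwa [div_mul_cancel₀ _ hux.ne'] at this
  have hxD : x ∈ D := by
    rw [hψ_apply] at hψx
    obtain ⟨⟨h1, h2, h3⟩, h4⟩ := hxZ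
    refine ⟨⟨hxU.1, h2.lt_of_ne fun h => ?_⟩, h3.lt_of_ne fun h => ?_, ?_⟩
    · simp [hb, ← h] at hψx
    · simp [hb, h] at hψx
    · have h5 : 0 < x n ^ 2 - ‖x‖ ^ 2 / N := pos_of_mul_pos_right hψx (sq_nonneg _)
      rw [sub_pos, div_lt_iff₀ (by linarith), mul_comm] at h5
      exact h5
  refine ⟨x, hxU.1, hxD.1.2, hxD.2.2, ?_⟩
  set τ := ψ x / u x with hτdef
  have hτu : τ * u x = ψ x := div_mul_cancel₀ _ hux.ne'
  have hloc : IsLocalMax (fun y => ψ y - τ * u y) x := by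
    filter_upwards [hDo.mem_nhds hxD] with y hy
    have hy' := hZU y (hDZ hy)
    have h1 : ψ y / u y ≤ τ := hmax (hDZ hy)
    rw [div_le_iff₀ (hpos y hy'.1 hy'.2)] at h1
    linarith
  have hle := divAgrad_le_of_isLocalMax_sub hk τ hx0 (hu.contDiffAt (hU.mem_nhds hxU))
    (hψ_diff hx0) hloc
  have hb' (s : ℝ) : HasDerivAt b (5 * S - 2 * s) s := by
    refine (((hasDerivAt_id s).sub_const S).mul ((hasDerivAt_id s).const_sub (4 * S))).congr_deriv ?_
    simp only [id]
    ring
  have hb'' (s : ℝ) : HasDerivAt (fun s => 5 * S - 2 * s) (-2) s := by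
    refine (((hasDerivAt_id s).const_mul 2).const_sub (5 * S)).congr_deriv ?_
    ring
  have hh (s : ℝ) : HasDerivAt (fun s => b s ^ 2) (2 * b s * (5 * S - 2 * s)) s := by
    refine ((hb' s).pow 2).congr_deriv ?_
    push_cast
    ring
  have hh' (s : ℝ) : HasDerivAt (fun s => 2 * b s * (5 * S - 2 * s))
      (2 * (5 * S - 2 * s) ^ 2 - 4 * b s) s := by
    refine (((hb' s).const_mul 2).mul (hb'' s)).congr_deriv ?_
    ring
  have hLψ := divAgrad_radialQuadratic k n
    (g₀ := fun s => -(s * b s ^ 2) / N)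
    (g₀' := fun s => -(b s ^ 2 + s * (2 * b s * (5 * S - 2 * s))) / N)
    (g₀'' := fun s => -(2 * (2 * b s * (5 * S - 2 * s))
      + s * (2 * (5 * S - 2 * s) ^ 2 - 4 * b s)) / N)
    (g₁ := fun _ => 0) (g₁' := fun _ => 0) (g₁'' := fun _ => 0) (g₂ := fun s => b s ^ 2)
    (by fun_prop) contDiffOn_const (by fun_prop)
    (fun s _ => (((hasDerivAt_id s).mul (hh s)).neg.div_const (N : ℝ)).congr_deriv (by
      simp only [id]
      ring))
    (fun s _ => (((hh s).add ((hasDerivAt_id s).mul (hh' s))).neg.div_const (N : ℝ)).congr_deriv (by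
      simp only [id]
      ring))
    (fun s _ => hasDerivAt_const s _) (fun s _ => hasDerivAt_const s _) (fun s _ => hh s)
    (fun s _ => hh' s) hx0
  rw [← hψ] at hLψ
  refine le_of_mul_le_mul_left ?_ hτ
  refine le_trans ?_ hle
  have e : τ * (-((8 * (N + 8) ^ 2 + 2 * N * k) / ‖x‖ ^ 2) * u x) =
      -((8 * (N + 8) ^ 2 + 2 * N * k) / ‖x‖ ^ 2) * ψ x := by
    rw [← hτu]
    ring
  rw [e, hLψ, hψ_apply]
  have hs1 := hxD.1.2
  have hs2 := hxD.2.1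
  have hH : 0 < x n ^ 2 - ‖x‖ ^ 2 / N := by
    rw [sub_pos, div_lt_iff₀ (by linarith), mul_comm]
    exact hxD.2.2
  set s := ‖x‖ ^ 2
  set a := x n
  have hs0 : 0 < s := hS0.trans hs1
  have hb0 : 0 < b s := mul_pos (sub_pos.mpr hs1) (sub_pos.mpr hs2)
  have hbsq : (5 * S - 2 * s) ^ 2 = 9 * S ^ 2 - 4 * b s := by
    simp only [hb]
    ring
  have hpoly : 0 ≤ 4 * s ^ 2 * (2 * (5 * S - 2 * s) ^ 2 - 4 * b s)
      + (2 * N + 8) * (2 * b s * (5 * S - 2 * s)) * s + (2 * N + 8 * (N + 8) ^ 2) * b s ^ 2 := by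
    rw [hbsq]
    have h1 : (2 * N + 8) * (2 * b s * (-3 * s)) * s ≤
        (2 * N + 8) * (2 * b s * (5 * S - 2 * s)) * s := by
      gcongr
      linarith
    have h2 : (96 + 12 * N) * b s * s * s ≤ (96 + 12 * N) * b s * s * (4 * S) := by
      gcongr
    have h3 : 0 ≤ 2 * N * b s ^ 2 := by positivity
    have h4 : 0 ≤ 72 * (s * S - (96 + 12 * N) / 36 * b s) ^ 2 := by positivity
    linarith
  have hfinal : 0 ≤ (a ^ 2 - s / N) / s * (4 * s ^ 2 * (2 * (5 * S - 2 * s) ^ 2 - 4 * b s)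
      + (2 * N + 8) * (2 * b s * (5 * S - 2 * s)) * s + (2 * N + 8 * (N + 8) ^ 2) * b s ^ 2) :=
    mul_nonneg (by positivity) hpoly
  rw [← sub_nonneg]
  refine hfinal.trans_eq ?_
  have hN0 : (N : ℝ) ≠ 0 := by positivity
  field_simp
  ring

lemma not_exists_pos_supersolution {k α γ q : ℝ} (hN : 2 ≤ N) (hk : 0 < k) (hα : α < 0)
    (hγ : 0 < γ) (hγα : γ = 2 - N - 2 * α) (hkα : k * (N - 1) = α * (α + N - 2)) (hq : 1 < q)
    (hqα : -1 ≤ α / 2 * (q - 1)) (n : Fin N) {ρ : ℝ} (hρ : 0 < ρ)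
    {u : EuclideanSpace ℝ (Fin N) → ℝ}
    (hu : ContDiffOn ℝ 2 u {x | 0 < x n ∧ ρ < ‖x‖})
    (hpos : ∀ x : EuclideanSpace ℝ (Fin N), 0 < x n → ρ < ‖x‖ → 0 < u x)
    (hsuper : ∀ x : EuclideanSpace ℝ (Fin N), 0 < x n → ρ < ‖x‖ →
      divAgrad (Amat k) u x ≤ -u x ^ q) : False := by
  obtain ⟨c, s₁, hc, hs₁, hs₁ρ, hlow⟩ := exists_log_lower_bound hk hα hγ hγα hkα (by linarith)
    (by linarith) n hρ hu hpos hsuper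
  have hN' : (2 : ℝ) ≤ N := by exact_mod_cast hN
  have htend : Tendsto (fun S => (c / N * (log S - log s₁)) ^ (q - 1)) atTop atTop :=
    (tendsto_rpow_atTop (by linarith)).comp
      ((tendsto_atTop_add_const_right atTop (-log s₁) Real.tendsto_log_atTop).const_mul_atTop
        (by positivity))
  obtain ⟨S, hSK, hSs⟩ := ((htend.eventually_gt_atTop (8 * (N + 8) ^ 2 + 2 * N * k)).and
    (eventually_ge_atTop s₁)).exists
  obtain ⟨x, hx, hxS, hxN, hle⟩ := exists_neg_div_mul_le_divAgrad hk.le hN n hρ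
    (hs₁ρ.trans_le hSs) hu hpos
  have hxρ : ρ < ‖x‖ :=
    lt_of_pow_lt_pow_left₀ 2 (norm_nonneg x) (hs₁ρ.trans (hSs.trans_lt hxS))
  have hux := hpos x hx hxρ
  have hux' := hsuper x hx hxρ
  have hl := hlow x hx (hSs.trans hxS.le)
  have ht1 := coord_div_sqrt_le_one x n
  set s := ‖x‖ ^ 2
  have hs1 : 1 ≤ s := by linarith
  have hs0 : 0 < s := by linarith
  set t := x n / √s with ht
  have ht0 : 0 < t := by positivity
  have htN : 1 ≤ N * t := by
    have h1 : x n ^ 2 = t ^ 2 * s := by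
      rw [ht, div_pow, Real.sq_sqrt hs0.le, div_mul_cancel₀ _ hs0.ne']
    have h2 : 1 < N * t ^ 2 := by
      rw [h1, ← mul_assoc] at hxN
      exact (lt_mul_iff_one_lt_left hs0).mp hxN
    nlinarith
  have hlogS : 0 ≤ log S - log s₁ := sub_nonneg.mpr (Real.log_le_log (by linarith) hSs)
  have h1 : s ^ (α / 2) * (c / N * (log S - log s₁)) ≤ u x := by
    refine le_trans ?_ hl
    rw [mul_assoc]
    refine mul_le_mul_of_nonneg_left ?_ (by positivity)
    have h2 : log S ≤ log s := Real.log_le_log (by linarith) hxS.le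
    calc c / N * (log S - log s₁) ≤ c / N * (log S - log s₁) * (N * t) :=
          le_mul_of_one_le_right (by positivity) htN
      _ = t * (c * (log S - log s₁)) := by
          field_simp
      _ ≤ t * (c * (log s - log s₁)) := by gcongr
  have h2 : s⁻¹ * (8 * (N + 8) ^ 2 + 2 * N * k) < u x ^ (q - 1) := by
    refine lt_of_lt_of_le ?_ (Real.rpow_le_rpow (by positivity) h1 (by linarith))
    rw [Real.mul_rpow (by positivity) (by positivity), ← Real.rpow_mul hs0.le]
    refine mul_lt_mul' ?_ hSK (by positivity) (by positivity)
    rw [← Real.rpow_neg_one]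
    exact Real.rpow_le_rpow_of_exponent_le hs1 hqα
  have h3 : u x ^ q = u x ^ (q - 1) * u x := by
    rw [Real.rpow_sub_one hux.ne', div_mul_cancel₀ _ hux.ne']
  have h4 := mul_lt_mul_of_pos_right h2 hux
  rw [← h3, inv_mul_eq_div] at h4
  linarith

end Nonexistence

/-- Nonexistence half of Theorem 1.4 on the half-space cone: for `p ∈ (1, N/(N-2))`,
`α = -2/(p-1)`, `k = α(α+N-2)/(N-1)`, and any `1 < q ≤ p`, there is no positive
supersolution of `-div(A_p∇u) = u^q` on `C₊ ∩ {‖x‖ > ρ}`. -/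
theorem Ap_nonexistence_up_to_critical
    (N : ℕ) (hN : 3 ≤ N) (p : ℝ) (hp : p ∈ Set.Ioo 1 ((N : ℝ) / ((N : ℝ) - 2)))
    (α k : ℝ) (hα : α = -2 / (p - 1)) (hk : k = α * (α + (N : ℝ) - 2) / ((N : ℝ) - 1)) :
    ∀ q : ℝ, 1 < q → q ≤ p → ∀ ρ : ℝ, 0 < ρ →
      ¬ ∃ u : EuclideanSpace ℝ (Fin N) → ℝ,
          ContDiffOn ℝ 2 u {x | 0 < lastCoord x ∧ ρ < ‖x‖} ∧
          (∀ x : EuclideanSpace ℝ (Fin N), 0 < lastCoord x → ρ < ‖x‖ → 0 < u x) ∧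
          (∀ x : EuclideanSpace ℝ (Fin N), 0 < lastCoord x → ρ < ‖x‖ →
            -divAgrad (Amat k) u x ≥ u x ^ q) := by
  rintro q hq hqp ρ hρ ⟨u, hu, hpos, hsuper⟩
  obtain ⟨hp1, hpN⟩ := hp
  have hN' : (3 : ℝ) ≤ N := by exact_mod_cast hN
  have hN0 : 0 < N := by lia
  have hp0 : 0 < p - 1 := by linarith
  have hαp : α * (p - 1) = -2 := by rw [hα, div_mul_cancel₀ _ hp0.ne']
  rw [lt_div_iff₀ (by linarith)] at hpN
  have hα2 : α < 2 - N := by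
    rw [hα, div_lt_iff₀ hp0]
    linarith
  have hα0 : α < 0 := by linarith
  have hkα : k * (N - 1) = α * (α + N - 2) := by
    rw [hk, div_mul_cancel₀ _ (by linarith)]
  have hk0 : 0 < k := by
    rw [hk]
    exact div_pos (mul_pos_of_neg_of_neg hα0 (by linarith)) (by linarith)
  have hlast (x : EuclideanSpace ℝ (Fin N)) :
      lastCoord x = x ⟨N - 1, Nat.sub_lt hN0 Nat.one_pos⟩ := dif_pos hN0
  simp only [hlast] at hu hpos hsuper
  exact not_exists_pos_supersolution (by lia) hk0 hα0 (show 0 < 2 - N - 2 * α by linarith) rfl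
    hkα hq (by nlinarith) _ hρ hu hpos fun x h1 h2 => by linarith [hsuper x h1 h2]
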